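/- arXiv:math/0403246 — 3 statements merged into one kernel-verified Lean document; each statement's English description precedes it below -/
import Mathlib

section
/- Suppose A, B, C, D ∈ End(ℂⁿ⊗ℂⁿ) satisfy the Yang–Baxter consistency relations A₁₂A₁₃A₂₃=A₂₃A₁₃A₁₂, A₁₂C₁₃C₂₃=C₂₃C₁₃A₁₂, D₁₂D₁₃D₂₃=D₂₃D₁₃D₁₂, D₁₂B₁₃B₂₃=B₂₃B₁₃D₁₂. Then for any three pairwise disjoint ordered label sets M, N′, L″ the fused Yang–Baxter equations hold as identities in End(V^{⊗(M∪N′∪L″)}): A_{MN̄′}A_{ML̄″}A_{N′L̄″} = A_{N′L̄″}A_{ML̄″}A_{MN̄′}; A_{MN̄′}C_{ML″}C_{N′L″} = C_{N′L″}C_{ML″}A_{MN̄′}; D_{MN̄′}D_{ML̄″}D_{N′L̄″} = D_{N′L̄″}D_{ML̄″}D_{MN̄′}; and D_{MN̄′}B_{ML″}B_{N′L″} = B_{N′L″}B_{ML″}D_{MN̄′}. -/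
open Matrix

namespace QT

variable {n : ℕ} {ι : Type*} [Fintype ι] [DecidableEq ι] {α : Type*}
variable {R : Type*} [Ring R] [Algebra ℂ R]

/-- Operators on `V^{⊗ι}`, `V = ℂⁿ`, with entries in `α`. -/
abbrev Tens (ι : Type*) (n : ℕ) (α : Type*) := Matrix (ι → Fin n) (ι → Fin n) α

/-- Two-site matrices, i.e. elements of `End(V ⊗ V)` with entries in `α`. -/
abbrev M2 (n : ℕ) (α : Type*) := Matrix (Fin n × Fin n) (Fin n × Fin n) α

/-- `X_{ij}` : embedding of a two-site matrix at the (distinct) sites `i, j`,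
acting as the identity elsewhere. -/
noncomputable def emb2 [MulZeroOneClass α] (X : M2 n α) (i j : ι) : Tens ι n α :=
  Matrix.of fun f g =>
    if ∀ k, k ≠ i → k ≠ j → f k = g k then X (f i, f j) (g i, g j) else 0

/-- `T_i` : embedding of a one-site matrix at site `i`. -/
noncomputable def emb1 [Zero α] (T : Matrix (Fin n) (Fin n) α) (i : ι) : Tens ι n α :=
  Matrix.of fun f g => if ∀ k, k ≠ i → f k = g k then T (f i) (g i) else 0

/-- Fused matrix `X_{MN} = ∏→_{i∈M} ∏→_{j∈N} X_{ij}` (a bar, i.e. reversal of one of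
the ordered label sets, is obtained by passing `M.reverse` or `N.reverse`). -/
noncomputable def fuse [Semiring α] (X : M2 n α) (M N : List ι) : Tens ι n α :=
  (M.map fun i => (N.map fun j => emb2 X i j).prod).prod

/-- Partial transposition `t_S` in the factors labelled by `S`. -/
noncomputable def ptrans (S : Finset ι) (X : Tens ι n α) : Tens ι n α :=
  Matrix.of fun f g =>
    X (fun k => if k ∈ S then g k else f k) (fun k => if k ∈ S then f k else g k)

/-- Partial transposition `t₁` on a two-site matrix. -/
noncomputable def t1 (X : M2 n α) : M2 n α :=
  Matrix.of fun p q => X (q.1, p.2) (p.1, q.2)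

/-- Partial transposition `t₂` on a two-site matrix. -/
noncomputable def t2 (X : M2 n α) : M2 n α :=
  Matrix.of fun p q => X (p.1, q.2) (q.1, p.2)

/-- `X₂₁ = P X₁₂ P` : permutation of the two factors of a two-site matrix. -/
noncomputable def perm2 (X : M2 n α) : M2 n α :=
  Matrix.of fun p q => X (p.2, p.1) (q.2, q.1)

/-- The permutation (flip) matrix `P` on `V ⊗ V`. -/
noncomputable def PM (n : ℕ) (α : Type*) [Zero α] [One α] : M2 n α :=
  Matrix.of fun p q => if p.1 = q.2 ∧ p.2 = q.1 then 1 else 0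

/-- Index type for `V^{⊗M}`. -/
abbrev idx (n : ℕ) {ι : Type*} [DecidableEq ι] (M : List ι) :=
  {x // x ∈ M.toFinset} → Fin n

/-- Embedding `End(V^{⊗M}) ⊗ R → End(V^{⊗ι}) ⊗ R`, acting as the identity off `M`. -/
noncomputable def embS [Zero α] (M : List ι) (X : Matrix (idx n M) (idx n M) α) :
    Tens ι n α :=
  Matrix.of fun f g =>
    if ∀ k, k ∉ M.toFinset → f k = g k then
      X (fun i => f i.1) (fun i => g i.1) else 0

/-- A pair of disjoint ordered label sets. -/
def OkPair (M N : List ι) : Prop := M.Nodup ∧ N.Nodup ∧ M.Disjoint N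

/-- Fused solution `T_M = ∏→_{i∈M} ( T_i ∏→_{j∈M, j>i} B_{ij} )` of the quadratic
exchange algebra (also used for the dual fusion, with `B` replaced by the
appropriate dual structure matrix). -/
noncomputable def fuseT (B : M2 n ℂ) (T : Matrix (Fin n) (Fin n) R) :
    List ι → Tens ι n R
  | [] => 1
  | i :: M => emb1 T i *
      ((M.map fun j => (emb2 B i j).map (algebraMap ℂ R)).prod) * fuseT B T M

/-- The chain `X̌_{i₁i₂} X̌_{i₂i₃} ⋯ X̌_{i_{m-1}i_m}` along the ordered label set,
where `X̌_{ij} = P_{ij} X_{ij}`. -/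
noncomputable def chainCheck (X : M2 n ℂ) : List ι → Tens ι n ℂ
  | [] => 1
  | [_] => 1
  | i :: j :: M => emb2 (PM n ℂ * X) i j * chainCheck X (j :: M)

/-- The lexicographically ordered product `L_M = ∏_{i<j ∈ M} A_{ij}`. -/
noncomputable def lexA (A : M2 n ℂ) : List ι → Tens ι n ℂ
  | [] => 1
  | i :: M => (M.map fun j => emb2 A i j).prod * lexA A M

/-- DKM-type fused solution
`T̃_M = ∏→_{i∈M} ( (∏→_{j>i} A_{ij}) T_i (∏←_{j>i} B_{ij}) )`. -/
noncomputable def fuseT2 (A B : M2 n ℂ) (T : Matrix (Fin n) (Fin n) R) :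
    List ι → Tens ι n R
  | [] => 1
  | i :: M => ((M.map fun j => emb2 A i j).prod).map (algebraMap ℂ R) * emb1 T i *
      ((M.reverse.map fun j => emb2 B i j).prod).map (algebraMap ℂ R) * fuseT2 A B T M

/-! ### Dynamical setting -/

/-- the space of dynamical parameters `λ ∈ ℂⁿ`. -/
abbrev Lam (n : ℕ) := Fin n → ℂ

/-- standard basis vector `e_a` of `ℂⁿ`. -/
noncomputable def ee {n : ℕ} (a : Fin n) : Lam n := Pi.single a 1

/-- `Σ_{k∈S} e_{f k}` : the dynamical shift read off the indices at the factors in `S`. -/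
noncomputable def shL (S : Finset ι) (f : ι → Fin n) : Lam n := ∑ k ∈ S, ee (f k)

/-- The dynamical shift `X(λ + h_S)` of a matrix-valued function of `λ` (which is
assumed to act as the identity on the factors labelled by `S`). -/
noncomputable def dsh (S : Finset ι) (X : Lam n → Tens ι n α) : Lam n → Tens ι n α :=
  fun lam => Matrix.of fun f g => X (lam + shL S f) f g

/-- Dynamical structure matrices `ℂⁿ → End(V⊗V)`. -/
abbrev DSM (n : ℕ) := Lam n → M2 n ℂ

/-- Fused `A_{MN̄′}` (no dynamical shifts occur in the recursion for `A`). -/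
noncomputable def fuseAd (A : DSM n) (M N : List ι) : Lam n → Tens ι n ℂ :=
  fun lam => fuse (A lam) M N.reverse

/-- Fused `B_{MN′} = B_{1N′} ⋅ B_{M₀N′}(λ+h₁)`. -/
noncomputable def fuseBd (B : DSM n) : List ι → List ι → Lam n → Tens ι n ℂ
  | [], _ => fun _ => 1
  | i :: M, N => fun lam =>
      ((N.map fun j => emb2 (B lam) i j).prod) * dsh {i} (fuseBd B M N) lam

/-- Fused `C_{MN′} = C_{M1′} ⋅ C_{MN′₀}(λ+h_{1′})`. -/
noncomputable def fuseCd (C : DSM n) : List ι → List ι → Lam n → Tens ι n ℂ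
  | _, [] => fun _ => 1
  | M, j :: N => fun lam =>
      ((M.map fun i => emb2 (C lam) i j).prod) * dsh {j} (fuseCd C M N) lam

/-- Fused `D_{iN̄′} = D_{in′}(λ+h_{(1′,n′-1)}) ⋅ D_{i,(N̄′)₀}` (`Nr` is the reversed `N′`). -/
noncomputable def fuseD1 (D : DSM n) (i : ι) : List ι → Lam n → Tens ι n ℂ
  | [] => fun _ => 1
  | j :: Nr => fun lam =>
      dsh Nr.toFinset (fun mu => emb2 (D mu) i j) lam * fuseD1 D i Nr lam

/-- Fused `D_{MN̄′} = D_{1N̄′} ⋅ D_{M₀N̄′}(λ+h₁)`. -/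
noncomputable def fuseDd (D : DSM n) : List ι → List ι → Lam n → Tens ι n ℂ
  | [], _ => fun _ => 1
  | i :: M, N => fun lam => fuseD1 D i N.reverse lam * dsh {i} (fuseDd D M N) lam

/-- zero-weight condition on the first factor: `[B₁₂, h⊗1] = 0` for all diagonal `h`. -/
def WB (B : DSM n) : Prop := ∀ lam (d : Fin n → ℂ),
  B lam * Matrix.diagonal (fun p => d p.1) = Matrix.diagonal (fun p => d p.1) * B lam

/-- zero-weight condition on the second factor: `[C₁₂, 1⊗h] = 0` for all diagonal `h`. -/
def WC (C : DSM n) : Prop := ∀ lam (d : Fin n → ℂ),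
  C lam * Matrix.diagonal (fun p => d p.2) = Matrix.diagonal (fun p => d p.2) * C lam

/-- total zero-weight condition: `[D₁₂, h⊗1 + 1⊗h] = 0` for all diagonal `h`. -/
def WD (D : DSM n) : Prop := ∀ lam (d : Fin n → ℂ),
  D lam * Matrix.diagonal (fun p => d p.1 + d p.2)
    = Matrix.diagonal (fun p => d p.1 + d p.2) * D lam

/-- The four coupled semi-dynamical Yang–Baxter equations, on `V⊗V⊗V`. -/
def SDYB (A B C D : DSM n) : Prop :=
  (∀ lam, emb2 (ι := Fin 3) (A lam) 0 1 * emb2 (A lam) 0 2 * emb2 (A lam) 1 2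
      = emb2 (A lam) 1 2 * emb2 (A lam) 0 2 * emb2 (A lam) 0 1) ∧
  (∀ lam, dsh {2} (fun mu => emb2 (ι := Fin 3) (D mu) 0 1) lam * emb2 (D lam) 0 2 *
        dsh {0} (fun mu => emb2 (D mu) 1 2) lam
      = emb2 (D lam) 1 2 * dsh {1} (fun mu => emb2 (D mu) 0 2) lam * emb2 (D lam) 0 1) ∧
  (∀ lam, emb2 (ι := Fin 3) (D lam) 0 1 * emb2 (B lam) 0 2 *
        dsh {0} (fun mu => emb2 (B mu) 1 2) lam
      = emb2 (B lam) 1 2 * dsh {1} (fun mu => emb2 (B mu) 0 2) lam * emb2 (D lam) 0 1) ∧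
  (∀ lam, emb2 (ι := Fin 3) (A lam) 0 1 * emb2 (C lam) 0 2 * emb2 (C lam) 1 2
      = emb2 (C lam) 1 2 * emb2 (C lam) 0 2 * dsh {2} (fun mu => emb2 (A mu) 0 1) lam)

/-- Fused semi-dynamical solution
`T_M(λ) = ∏→_{i∈M} ( T_i(λ + h_{{k∈M : k<i}}) ∏→_{j∈M, j>i} B_{ij}(λ) )`. -/
noncomputable def fuseTd (B : DSM n) (T : Lam n → Matrix (Fin n) (Fin n) R)
    (M : List ι) : Lam n → Tens ι n R := fun lam =>
  (M.map fun i =>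
    dsh ((M.takeWhile (fun k => decide (k ≠ i))).toFinset)
        (fun mu => emb1 (T mu) i) lam *
    ((((M.dropWhile (fun k => decide (k ≠ i))).tail).map fun j =>
        emb2 (B lam) i j).prod).map (algebraMap ℂ R)).prod


section embedding

variable {κ : Type*} [Fintype κ] [DecidableEq κ]

/-- The operator on `V^{⊗ι}` acting as `X` on the factors labelled by the image of `e` and as the
identity elsewhere. -/
noncomputable def embAlong [Zero α] (e : κ → ι) (X : Tens κ n α) : Tens ι n α :=
  Matrix.of fun f g => if ∀ k, (∀ a, k ≠ e a) → f k = g k then X (f ∘ e) (g ∘ e) else 0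

theorem embAlong_mul [NonUnitalNonAssocSemiring α] {e : κ → ι} (he : Function.Injective e)
    (X Y : Tens κ n α) : embAlong e (X * Y) = embAlong e X * embAlong e Y := by
  ext f g
  simp only [embAlong, Matrix.mul_apply, Matrix.of_apply]
  have hoff : ∀ (h' : κ → Fin n) k, (∀ a, k ≠ e a) → Function.extend e h' f k = f k :=
    fun h' k hk => Function.extend_apply' _ _ _ fun ⟨a, ha⟩ => hk a ha.symm
  have hon : ∀ h' : κ → Fin n, Function.extend e h' f ∘ e = h' :=
    fun h' => Function.extend_comp he _ _
  split_ifs with hfg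
  · refine Finset.sum_of_injOn (fun h' => Function.extend e h' f) ?_ (by simp) ?_ ?_
    · intro h₁ _ h₂ _ h
      rw [← hon h₁, ← hon h₂]
      exact congrArg (· ∘ e) h
    · intro h _ hh
      rw [if_neg, zero_mul]
      intro hfh
      apply hh
      refine ⟨h ∘ e, by simp, ?_⟩
      funext k
      by_cases hk : ∃ a, e a = k
      · obtain ⟨a, rfl⟩ := hk
        exact he.extend_apply _ _ _
      · push Not at hk
        rw [← hfh k fun a ha => hk a ha.symm]
        exact hoff _ k fun a ha => hk a ha.symm
    · intro h' _
      rw [if_pos fun k hk => (hoff h' k hk).symm,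
        if_pos fun k hk => (hoff h' k hk).trans (hfg k hk), hon]
  · refine (Finset.sum_eq_zero fun h _ => ?_).symm
    by_cases hfh : ∀ k, (∀ a, k ≠ e a) → f k = h k
    · have hhg : ¬ ∀ k, (∀ a, k ≠ e a) → h k = g k :=
        fun hhg => hfg fun k hk => (hfh k hk).trans (hhg k hk)
      rw [if_neg hhg, mul_zero]
    · rw [if_neg hfh, zero_mul]

theorem embAlong_emb2 [MulZeroOneClass α] {e : κ → ι} (he : Function.Injective e) (X : M2 n α)
    (a b : κ) : embAlong e (emb2 X a b) = emb2 X (e a) (e b) := by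
  ext f g
  simp only [embAlong, emb2, Matrix.of_apply, Function.comp_apply, ← ite_and]
  congr 1
  refine propext ⟨fun ⟨h₁, h₂⟩ k hka hkb => ?_, fun h => ⟨fun k hk => h k (hk a) (hk b),
    fun c hca hcb => h (e c) (he.ne hca) (he.ne hcb)⟩⟩
  by_cases hk : ∃ c, e c = k
  · obtain ⟨c, rfl⟩ := hk
    exact h₂ c (ne_of_apply_ne e hka) (ne_of_apply_ne e hkb)
  · push Not at hk
    exact h₁ k fun c hc => hk c hc.symm

end embedding

theorem emb2_mul_emb2_apply [Semiring α] (X Y : M2 n α) {i j k l : ι} (hik : i ≠ k)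
    (hil : i ≠ l) (hjk : j ≠ k) (hjl : j ≠ l) (f g : ι → Fin n) :
    (emb2 X i j * emb2 Y k l) f g =
      if ∀ m, m ≠ i → m ≠ j → m ≠ k → m ≠ l → f m = g m then
        X (f i, f j) (g i, g j) * Y (f k, f l) (g k, g l) else 0 := by
  simp only [emb2, Matrix.mul_apply, Matrix.of_apply]
  rw [Finset.sum_eq_single fun m => if m = i ∨ m = j then g m else f m]
  · rw [if_pos (by grind)]
    simp only [true_or, or_true, if_true, hik.symm, hil.symm, hjk.symm, hjl.symm, or_self,
      if_false]
    split_ifs with h₁ h₂ h₂ <;> grind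
  · intro h _ hh
    by_cases h₁ : ∀ m, m ≠ i → m ≠ j → f m = h m
    · by_cases h₂ : ∀ m, m ≠ k → m ≠ l → h m = g m
      · exact absurd (funext fun m => by grind) hh
      · rw [if_neg h₂, mul_zero]
    · rw [if_neg h₁, zero_mul]
  · simp

theorem commute_emb2 [CommSemiring α] (X Y : M2 n α) {i j k l : ι} (hik : i ≠ k)
    (hil : i ≠ l) (hjk : j ≠ k) (hjl : j ≠ l) : Commute (emb2 X i j) (emb2 Y k l) := by
  ext f g
  rw [emb2_mul_emb2_apply X Y hik hil hjk hjl,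
    emb2_mul_emb2_apply Y X hik.symm hjk.symm hil.symm hjl.symm, mul_comm (X _ _)]
  congr 1
  exact propext ⟨fun h m hk hl hi hj => h m hi hj hk hl, fun h m hi hj hk hl => h m hk hl hi hj⟩

theorem emb2_yang_baxter [Semiring α] {A X : M2 n α}
    (h : emb2 (ι := Fin 3) A 0 1 * emb2 X 0 2 * emb2 X 1 2
      = emb2 X 1 2 * emb2 X 0 2 * emb2 A 0 1)
    {i j k : ι} (hij : i ≠ j) (hik : i ≠ k) (hjk : j ≠ k) :
    emb2 A i j * emb2 X i k * emb2 X j k = emb2 X j k * emb2 X i k * emb2 A i j := by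
  have he : Function.Injective ![i, j, k] := by
    intro a b hab
    fin_cases a <;> fin_cases b <;> simp_all
  simpa [embAlong_mul he, embAlong_emb2 he] using congrArg (embAlong ![i, j, k]) h

theorem fuse_nil_left [Semiring α] (X : M2 n α) (L : List ι) : fuse X [] L = 1 := rfl

theorem fuse_cons_left [Semiring α] (X : M2 n α) (i : ι) (M L : List ι) :
    fuse X (i :: M) L = fuse X [i] L * fuse X M L := by simp [fuse]

theorem fuse_singleton_nil [Semiring α] (X : M2 n α) (i : ι) : fuse X [i] [] = 1 := by
  simp [fuse]

theorem fuse_singleton_cons [Semiring α] (X : M2 n α) (i l : ι) (L : List ι) :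
    fuse X [i] (l :: L) = emb2 X i l * fuse X [i] L := by simp [fuse]

theorem fuse_singleton_append [Semiring α] (X : M2 n α) (i : ι) (L L' : List ι) :
    fuse X [i] (L ++ L') = fuse X [i] L * fuse X [i] L' := by simp [fuse]

theorem fuse_singleton_singleton [Semiring α] (X : M2 n α) (i l : ι) :
    fuse X [i] [l] = emb2 X i l := by simp [fuse]

theorem commute_fuse [CommSemiring α] (X Y : M2 n α) {M N K L : List ι} (hMK : M.Disjoint K)
    (hML : M.Disjoint L) (hNK : N.Disjoint K) (hNL : N.Disjoint L) :
    Commute (fuse X M N) (fuse Y K L) := by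
  have key : ∀ {Z : Tens ι n α} {K L : List ι} (W : M2 n α),
      (∀ k ∈ K, ∀ l ∈ L, Commute Z (emb2 W k l)) → Commute Z (fuse W K L) := by
    intro Z K L W h
    refine Commute.list_prod_right _ _ fun x hx => ?_
    obtain ⟨k, hk, rfl⟩ := List.mem_map.1 hx
    refine Commute.list_prod_right _ _ fun y hy => ?_
    obtain ⟨l, hl, rfl⟩ := List.mem_map.1 hy
    exact h k hk l hl
  refine key Y fun k hk l hl => (key X fun i hi j hj => ?_).symm
  refine (commute_emb2 X Y ?_ ?_ ?_ ?_).symm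
  · rintro rfl; exact hMK hi hk
  · rintro rfl; exact hML hi hl
  · rintro rfl; exact hNK hj hk
  · rintro rfl; exact hNL hj hl

section fusion

variable [CommSemiring α] {A X : M2 n α}

theorem emb2_fuse_yang_baxter
    (h : emb2 (ι := Fin 3) A 0 1 * emb2 X 0 2 * emb2 X 1 2
      = emb2 X 1 2 * emb2 X 0 2 * emb2 A 0 1)
    {i j : ι} {L : List ι} (hL : L.Nodup) (hij : i ≠ j) (hi : i ∉ L)
    (hj : j ∉ L) :
    emb2 A i j * fuse X [i] L * fuse X [j] L = fuse X [j] L * fuse X [i] L * emb2 A i j := by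
  induction L with
  | nil => simp [fuse_singleton_nil]
  | cons l L ih =>
    simp only [List.mem_cons, not_or] at hi hj
    rw [List.nodup_cons] at hL
    have hc {a b : ι} (hab : a ≠ b) (hb : b ∉ L) (ha : a ≠ l) :
        Commute (fuse X [a] L) (emb2 X b l) := by
      rw [← fuse_singleton_singleton]
      apply commute_fuse <;> simp_all [eq_comm]
    have hi' := hc hij hj.2 hi.1
    have hj' := hc hij.symm hi.2 hj.1
    have hyb := emb2_yang_baxter h hij hi.1 hj.1
    rw [fuse_singleton_cons, fuse_singleton_cons]
    calc _ = emb2 A i j * emb2 X i l * (fuse X [i] L * emb2 X j l) * fuse X [j] L := by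
          simp only [mul_assoc]
      _ = emb2 A i j * emb2 X i l * emb2 X j l * fuse X [i] L * fuse X [j] L := by
          rw [hi'.eq]; simp only [mul_assoc]
      _ = emb2 X j l * emb2 X i l * (emb2 A i j * fuse X [i] L * fuse X [j] L) := by
          rw [hyb]; simp only [mul_assoc]
      _ = emb2 X j l * (emb2 X i l * fuse X [j] L) * fuse X [i] L * emb2 A i j := by
          rw [ih hL.2 hi.2 hj.2]; simp only [mul_assoc]
      _ = _ := by rw [← hj'.eq]; simp only [mul_assoc]

theorem fuse_singleton_yang_baxter
    (h : emb2 (ι := Fin 3) A 0 1 * emb2 X 0 2 * emb2 X 1 2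
      = emb2 X 1 2 * emb2 X 0 2 * emb2 A 0 1)
    {i : ι} {N L : List ι} (hN : N.Nodup) (hL : L.Nodup)
    (hiN : i ∉ N) (hiL : i ∉ L) (hNL : N.Disjoint L) :
    fuse A [i] N.reverse * fuse X [i] L * fuse X N L
      = fuse X N L * fuse X [i] L * fuse A [i] N.reverse := by
  induction N with
  | nil => simp [fuse_nil_left, fuse_singleton_nil]
  | cons j N ih =>
    simp only [List.mem_cons, not_or] at hiN
    rw [List.nodup_cons] at hN
    rw [List.disjoint_cons_left] at hNL
    have hyb := emb2_fuse_yang_baxter h hL hiN.1 hiL hNL.1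
    have hij : Commute (emb2 A i j) (fuse X N L) := by
      rw [← fuse_singleton_singleton]
      apply commute_fuse <;> simp_all
    have hiN' : Commute (fuse A [i] N.reverse) (fuse X [j] L) := by
      apply commute_fuse <;> simp_all [eq_comm]
    rw [fuse_cons_left X j, List.reverse_cons, fuse_singleton_append, fuse_singleton_singleton]
    calc _ = fuse A [i] N.reverse * (emb2 A i j * fuse X [i] L * fuse X [j] L) * fuse X N L := by
          simp only [mul_assoc]
      _ = (fuse A [i] N.reverse * fuse X [j] L) * fuse X [i] L * (emb2 A i j * fuse X N L) := by
          rw [hyb]; simp only [mul_assoc]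
      _ = fuse X [j] L * (fuse A [i] N.reverse * fuse X [i] L * fuse X N L) * emb2 A i j := by
          rw [hij.eq, hiN'.eq]; simp only [mul_assoc]
      _ = _ := by rw [ih hN.2 hiN.2 hNL.2]; simp only [mul_assoc]

theorem fuse_yang_baxter
    (h : emb2 (ι := Fin 3) A 0 1 * emb2 X 0 2 * emb2 X 1 2
      = emb2 X 1 2 * emb2 X 0 2 * emb2 A 0 1)
    {M N L : List ι} (hM : M.Nodup) (hN : N.Nodup) (hL : L.Nodup)
    (hMN : M.Disjoint N) (hML : M.Disjoint L) (hNL : N.Disjoint L) :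
    fuse A M N.reverse * fuse X M L * fuse X N L
      = fuse X N L * fuse X M L * fuse A M N.reverse := by
  induction M with
  | nil => simp [fuse_nil_left]
  | cons i M ih =>
    rw [List.nodup_cons] at hM
    rw [List.disjoint_cons_left] at hMN hML
    have hyb := fuse_singleton_yang_baxter h hN hL hMN.1 hML.1 hNL
    have hMi : Commute (fuse A M N.reverse) (fuse X [i] L) := by
      apply commute_fuse <;> simp_all
    have hiM : Commute (fuse A [i] N.reverse) (fuse X M L) := by
      apply commute_fuse <;> simp_all [hMN.2.symm]
    rw [fuse_cons_left X i, fuse_cons_left A i]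
    calc _ = fuse A [i] N.reverse * (fuse A M N.reverse * fuse X [i] L) * fuse X M L
            * fuse X N L := by simp only [mul_assoc]
      _ = fuse A [i] N.reverse * fuse X [i] L
            * (fuse A M N.reverse * fuse X M L * fuse X N L) := by
          rw [hMi.eq]; simp only [mul_assoc]
      _ = fuse A [i] N.reverse * fuse X [i] L * fuse X N L * fuse X M L
            * fuse A M N.reverse := by
          rw [ih hM.2 hMN.2 hML.2]; simp only [mul_assoc]
      _ = fuse X N L * fuse X [i] L * (fuse A [i] N.reverse * fuse X M L)
            * fuse A M N.reverse := by rw [hyb]; simp only [mul_assoc]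
      _ = _ := by rw [hiM.eq]; simp only [mul_assoc]

end fusion

/-- the fused Yang–Baxter equations. -/
theorem fused_yang_baxter {n : ℕ} (hn : 1 ≤ n)
    (A B C D : M2 n ℂ)
    (hYBA : emb2 (ι := Fin 3) A 0 1 * emb2 A 0 2 * emb2 A 1 2
          = emb2 A 1 2 * emb2 A 0 2 * emb2 A 0 1)
    (hYBAC : emb2 (ι := Fin 3) A 0 1 * emb2 C 0 2 * emb2 C 1 2
          = emb2 C 1 2 * emb2 C 0 2 * emb2 A 0 1)
    (hYBD : emb2 (ι := Fin 3) D 0 1 * emb2 D 0 2 * emb2 D 1 2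
          = emb2 D 1 2 * emb2 D 0 2 * emb2 D 0 1)
    (hYBDB : emb2 (ι := Fin 3) D 0 1 * emb2 B 0 2 * emb2 B 1 2
          = emb2 B 1 2 * emb2 B 0 2 * emb2 D 0 1)
    {ι : Type} [Fintype ι] [DecidableEq ι] (M N L : List ι)
    (hM : M.Nodup) (hN : N.Nodup) (hL : L.Nodup)
    (hMN : M.Disjoint N) (hML : M.Disjoint L) (hNL : N.Disjoint L) :
    fuse A M N.reverse * fuse A M L.reverse * fuse A N L.reverse
      = fuse A N L.reverse * fuse A M L.reverse * fuse A M N.reverse ∧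
    fuse A M N.reverse * fuse C M L * fuse C N L
      = fuse C N L * fuse C M L * fuse A M N.reverse ∧
    fuse D M N.reverse * fuse D M L.reverse * fuse D N L.reverse
      = fuse D N L.reverse * fuse D M L.reverse * fuse D M N.reverse ∧
    fuse D M N.reverse * fuse B M L * fuse B N L
      = fuse B N L * fuse B M L * fuse D M N.reverse := by
  have hL' : L.reverse.Nodup := List.nodup_reverse.2 hL
  have hML' : M.Disjoint L.reverse := List.disjoint_reverse_right.2 hML
  have hNL' : N.Disjoint L.reverse := List.disjoint_reverse_right.2 hNL
  exact ⟨fuse_yang_baxter hYBA hM hN hL' hMN hML' hNL', fuse_yang_baxter hYBAC hM hN hL hMN hML hNL,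
    fuse_yang_baxter hYBD hM hN hL' hMN hML' hNL', fuse_yang_baxter hYBDB hM hN hL hMN hML hNL⟩

end QT
end

section
/- Suppose A, B, C, D ∈ End(ℂⁿ⊗ℂⁿ) satisfy the Yang–Baxter consistency relations and the unitarity conditions. For an ordered label set M = ⟨1,…,m⟩ define Q_M := Ǎ₁₂Ǎ₂₃⋯Ǎ_{m−1,m} and S_M := Ď₁₂Ď₂₃⋯Ď_{m−1,m}, where X̌_{ij} := P_{ij}X_{ij} with P_{ij} the permutation of the factors labelled i and j. Then for all disjoint ordered label sets M, N′ these matrices satisfy the dressing constraints: [Q_M, A_{MN̄′}] = [Q_{N′}, A_{MN̄′}] = [Q_{N′}, B_{MN′}] = [Q_M, C_{MN′}] = 0 and [S_M, D_{MN̄′}] = [S_{N′}, D_{MN̄′}] = [S_{N′}, C_{MN′}] = [S_M, B_{MN′}] = 0. -/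
open Matrix

namespace QT

variable {n : ℕ} {ι : Type*} [Fintype ι] [DecidableEq ι] {α : Type*}
variable {R : Type*} [Ring R] [Algebra ℂ R]

lemma emb2_mulVec (X : M2 n ℂ) {i j : ι} (hij : i ≠ j) (v : (ι → Fin n) → ℂ)
    (f : ι → Fin n) :
    (emb2 X i j *ᵥ v) f = ∑ p : Fin n × Fin n,
      X (f i, f j) p * v (Function.update (Function.update f i p.1) j p.2) := by
  simp only [Matrix.mulVec, dotProduct, emb2, Matrix.of_apply, ite_mul, zero_mul]
  rw [← Finset.sum_filter]
  refine Finset.sum_bij' (fun g _ => (g i, g j))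
    (fun p _ => Function.update (Function.update f i p.1) j p.2) ?_ ?_ ?_ ?_ ?_
  · simp
  · intro p _
    simp only [Finset.mem_filter, Finset.mem_univ, true_and]
    intro k hi hj
    simp [hi, hj]
  · intro g hg
    simp only [Finset.mem_filter, Finset.mem_univ, true_and] at hg
    ext k
    by_cases hj : k = j
    · subst hj; simp
    · by_cases hi : k = i
      · subst hi; simp [hj]
      · simp [hi, hj, hg k hi hj]
  · intro p _
    simp [hij]
  · intro g hg
    simp only [Finset.mem_filter, Finset.mem_univ, true_and] at hg
    congr 2
    ext k
    by_cases hj : k = j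
    · subst hj; simp
    · by_cases hi : k = i
      · subst hi; simp [hj]
      · simp [hi, hj, hg k hi hj]

lemma tens_ext {X Y : Tens ι n ℂ} (h : ∀ v, X *ᵥ v = Y *ᵥ v) : X = Y :=
  Matrix.mulVec_injective (funext h)

lemma emb2_mul (X Y : M2 n ℂ) {i j : ι} (hij : i ≠ j) :
    emb2 (X * Y) i j = emb2 X i j * emb2 Y i j := by
  refine tens_ext fun v => funext fun f => ?_
  rw [← Matrix.mulVec_mulVec, emb2_mulVec _ hij, emb2_mulVec _ hij]
  simp only [emb2_mulVec _ hij, Matrix.mul_apply, Finset.sum_mul, Finset.mul_sum]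
  rw [Finset.sum_comm]
  refine Finset.sum_congr rfl fun p _ => Finset.sum_congr rfl fun q _ => ?_
  have : Function.update (Function.update (Function.update (Function.update f i p.1) j p.2)
      i q.1) j q.2 = Function.update (Function.update f i q.1) j q.2 := by
    rw [Function.update_comm hij.symm, Function.update_idem, Function.update_idem]
  simp [this, hij, mul_assoc]

lemma emb2_one (i j : ι) : emb2 (1 : M2 n ℂ) i j = 1 := by
  ext f g
  simp only [emb2, Matrix.of_apply, Matrix.one_apply, Prod.mk.injEq, ← ite_and]
  congr 1
  refine propext ⟨fun h => funext fun k => ?_, fun h => by simp [h]⟩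
  by_cases hi : k = i
  · exact hi ▸ h.2.1
  · by_cases hj : k = j
    · exact hj ▸ h.2.2
    · exact h.1 k hi hj

lemma emb2_perm2 (X : M2 n ℂ) (i j : ι) : emb2 (perm2 X) i j = emb2 X j i := by
  ext f g
  simp only [emb2, perm2, Matrix.of_apply]
  congr 1
  exact propext ⟨fun h k a b => h k b a, fun h k a b => h k b a⟩

lemma perm2_perm2 (X : M2 n ℂ) : perm2 (perm2 X) = X := rfl

lemma emb2_commute (X Y : M2 n ℂ) {i j k l : ι} (hij : i ≠ j) (hkl : k ≠ l)
    (hik : i ≠ k) (hil : i ≠ l) (hjk : j ≠ k) (hjl : j ≠ l) :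
    Commute (emb2 X i j) (emb2 Y k l) := by
  refine tens_ext fun v => funext fun f => ?_
  rw [← Matrix.mulVec_mulVec, ← Matrix.mulVec_mulVec, emb2_mulVec _ hij, emb2_mulVec _ hkl]
  simp only [emb2_mulVec _ hij, emb2_mulVec _ hkl, Finset.mul_sum]
  rw [Finset.sum_comm]
  refine Finset.sum_congr rfl fun p _ => Finset.sum_congr rfl fun q _ => ?_
  have : Function.update (Function.update (Function.update (Function.update f i q.1) j q.2)
      k p.1) l p.2 =
      Function.update (Function.update (Function.update (Function.update f k p.1) l p.2)
      i q.1) j q.2 := by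
    rw [Function.update_comm hjk, Function.update_comm hjl, Function.update_comm hik,
      Function.update_comm hil]
  simp [this, hik, hil, hjk, hjl, hik.symm, hil.symm, hjk.symm, hjl.symm, mul_left_comm]

lemma emb2_mulVec_extend {κ : Type*} [Fintype κ] [DecidableEq κ] {e : κ → ι}
    (he : Function.Injective e) (X : M2 n ℂ) {a b : κ} (hab : a ≠ b)
    (f : ι → Fin n) (v : (ι → Fin n) → ℂ) :
    (fun g => (emb2 X (e a) (e b) *ᵥ v) (Function.extend e g f)) =
      emb2 X a b *ᵥ fun g => v (Function.extend e g f) := by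
  have hupd : ∀ (g : κ → Fin n) (c : κ) (x : Fin n),
      Function.update (Function.extend e g f) (e c) x =
        Function.extend e (Function.update g c x) f := by
    intro g c x
    ext k
    by_cases hk : ∃ d, e d = k
    · obtain ⟨d, rfl⟩ := hk
      by_cases hd : d = c
      · subst hd; simp [he.extend_apply]
      · simp [he.extend_apply, hd, he.ne hd]
    · have : k ≠ e c := fun h => hk ⟨c, h.symm⟩
      simp [Function.extend_apply' _ _ _ hk, this]
  funext g
  rw [emb2_mulVec _ hab, emb2_mulVec _ (he.ne hab)]
  simp only [hupd, he.extend_apply]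

lemma exchange_of_fin_three {X Y : M2 n ℂ}
    (h : emb2 (ι := Fin 3) X 0 1 * emb2 Y 0 2 * emb2 Y 1 2
       = emb2 Y 1 2 * emb2 Y 0 2 * emb2 X 0 1)
    {i j k : ι} (hij : i ≠ j) (hik : i ≠ k) (hjk : j ≠ k) :
    emb2 X i j * emb2 Y i k * emb2 Y j k = emb2 Y j k * emb2 Y i k * emb2 X i j := by
  have he : Function.Injective ![i, j, k] := by
    intro a b hab
    fin_cases a <;> fin_cases b <;> simp_all
  have h01 := fun Z : M2 n ℂ =>
    emb2_mulVec_extend he Z (show (0 : Fin 3) ≠ 1 by decide)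
  have h02 := fun Z : M2 n ℂ =>
    emb2_mulVec_extend he Z (show (0 : Fin 3) ≠ 2 by decide)
  have h12 := fun Z : M2 n ℂ =>
    emb2_mulVec_extend he Z (show (1 : Fin 3) ≠ 2 by decide)
  refine tens_ext fun v => funext fun f => ?_
  have hv := congrFun (congrArg (fun Z => Z *ᵥ fun g => v (Function.extend ![i, j, k] g f)) h)
    (f ∘ ![i, j, k])
  simp only [← Matrix.mulVec_mulVec, ← h01, ← h02, ← h12] at hv ⊢
  have hf : Function.extend ![i, j, k] (f ∘ ![i, j, k]) f = f := by
    ext l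
    by_cases hl : ∃ d, ![i, j, k] d = l
    · obtain ⟨d, rfl⟩ := hl
      rw [he.extend_apply]; rfl
    · rw [Function.extend_apply' _ _ _ hl]
  rw [hf] at hv
  exact hv

lemma emb2_PM_mulVec {i j : ι} (hij : i ≠ j) (v : (ι → Fin n) → ℂ) (f : ι → Fin n) :
    (emb2 (PM n ℂ) i j *ᵥ v) f =
      v (Function.update (Function.update f i (f j)) j (f i)) := by
  rw [emb2_mulVec _ hij, Finset.sum_eq_single (f j, f i)]
  · simp [PM]
  · rintro ⟨a, b⟩ _ hne
    have : ¬ (f i = b ∧ f j = a) := by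
      rintro ⟨rfl, rfl⟩
      exact hne rfl
    simp [PM, this]
  · simp

lemma emb2_PM_mul_emb2 (Y : M2 n ℂ) {i j k : ι} (hij : i ≠ j) (hik : i ≠ k) (hjk : j ≠ k) :
    emb2 (PM n ℂ) i j * emb2 Y j k = emb2 Y i k * emb2 (PM n ℂ) i j := by
  refine tens_ext fun v => funext fun f => ?_
  rw [← Matrix.mulVec_mulVec, ← Matrix.mulVec_mulVec, emb2_PM_mulVec hij, emb2_mulVec _ hjk,
    emb2_mulVec _ hik]
  simp only [emb2_PM_mulVec hij]
  refine Finset.sum_congr rfl fun p _ => ?_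
  have : Function.update (Function.update (Function.update f i (f j)) j p.1) k p.2 =
      Function.update (Function.update (Function.update (Function.update f i p.1) k p.2)
      i (f j)) j p.1 := by
    rw [Function.update_comm hik.symm, Function.update_idem,
      Function.update_comm hjk]
  simp [this, hjk, hij.symm, hik.symm, hik, hjk.symm]

lemma emb2_PM_mul_emb2' (Y : M2 n ℂ) {i j k : ι} (hij : i ≠ j) (hik : i ≠ k) (hjk : j ≠ k) :
    emb2 (PM n ℂ) i j * emb2 Y i k = emb2 Y j k * emb2 (PM n ℂ) i j := by
  have hPM : perm2 (PM n ℂ) = PM n ℂ := by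
    ext p q
    simp [perm2, PM, and_comm]
  have h := emb2_PM_mul_emb2 Y hij.symm hjk hik
  rwa [← emb2_perm2, hPM] at h

lemma check_commute {X Y : M2 n ℂ}
    (h : emb2 (ι := Fin 3) X 0 1 * emb2 Y 0 2 * emb2 Y 1 2
       = emb2 Y 1 2 * emb2 Y 0 2 * emb2 X 0 1)
    {i j k : ι} (hij : i ≠ j) (hik : i ≠ k) (hjk : j ≠ k) :
    Commute (emb2 (PM n ℂ * X) i j) (emb2 Y i k * emb2 Y j k) := by
  rw [Commute, SemiconjBy, emb2_mul _ _ hij]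
  calc emb2 (PM n ℂ) i j * emb2 X i j * (emb2 Y i k * emb2 Y j k)
      = emb2 (PM n ℂ) i j * (emb2 X i j * emb2 Y i k * emb2 Y j k) := by
        simp only [mul_assoc]
    _ = emb2 (PM n ℂ) i j * emb2 Y j k * emb2 Y i k * emb2 X i j := by
        rw [exchange_of_fin_three h hij hik hjk]; simp only [mul_assoc]
    _ = emb2 Y i k * (emb2 (PM n ℂ) i j * emb2 Y i k) * emb2 X i j := by
        rw [emb2_PM_mul_emb2 Y hij hik hjk]; simp only [mul_assoc]
    _ = _ := by
        rw [emb2_PM_mul_emb2' Y hij hik hjk]; simp only [mul_assoc]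

lemma prod_map_mul_of_commute {κ G : Type*} [Monoid G] (f g : κ → G) :
    ∀ {l : List κ}, l.Pairwise (fun a b => Commute (g a) (f b)) →
      (l.map fun a => f a * g a).prod = (l.map f).prod * (l.map g).prod
  | [], _ => by simp
  | a :: l, h => by
    rw [List.pairwise_cons] at h
    have hc : Commute (g a) (l.map f).prod :=
      Commute.list_prod_right _ _ (by simpa using h.1)
    simp only [List.map_cons, List.prod_cons, prod_map_mul_of_commute f g h.2, mul_assoc]
    rw [← mul_assoc (g a), hc.eq, mul_assoc]

lemma chainCheck_commute {X : M2 n ℂ} {Z : Tens ι n ℂ} :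
    ∀ {M : List ι}, M.Nodup →
      (∀ a ∈ M, ∀ b ∈ M, a ≠ b → Commute (emb2 (PM n ℂ * X) a b) Z) →
      Commute (chainCheck X M) Z
  | [], _, _ => Commute.one_left Z
  | [_], _, _ => Commute.one_left Z
  | i :: j :: M, hM, h => by
    rw [chainCheck]
    refine (h i (by simp) j (by simp) ?_).mul_left (chainCheck_commute hM.of_cons ?_)
    · rintro rfl
      simp at hM
    · exact fun a ha b hb => h a (List.mem_cons_of_mem _ ha) b (List.mem_cons_of_mem _ hb)

lemma fuse_cons (Y : M2 n ℂ) (i : ι) (M N : List ι) :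
    fuse Y (i :: M) N = (N.map fun k => emb2 Y i k).prod * fuse Y M N := by
  simp [fuse]

lemma chainCheck_commute_fuse {X Y : M2 n ℂ}
    (h : emb2 (ι := Fin 3) X 0 1 * emb2 Y 0 2 * emb2 Y 1 2
       = emb2 Y 1 2 * emb2 Y 0 2 * emb2 X 0 1) {N : List ι} (hN : N.Nodup) :
    ∀ {M : List ι}, M.Nodup → M.Disjoint N → Commute (chainCheck X M) (fuse Y M N)
  | [], _, _ => Commute.one_left _
  | [_], _, _ => Commute.one_left _
  | i :: j :: M, hM, hd => by
    have hij : i ≠ j := by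
      rintro rfl
      simp at hM
    have hne : ∀ a ∈ i :: j :: M, ∀ k ∈ N, a ≠ k := fun a ha k hk e => hd ha (e ▸ hk)
    have hiM : ∀ a ∈ j :: M, a ≠ i := fun a ha e => (List.nodup_cons.1 hM).1 (e ▸ ha)
    have hjM : ∀ a ∈ M, a ≠ j :=
      fun a ha e => (List.nodup_cons.1 hM.of_cons).1 (e ▸ ha)
    have ih := chainCheck_commute_fuse h hN hM.of_cons (List.disjoint_of_disjoint_cons_left hd)
    have hrow : Commute (chainCheck X (j :: M)) (N.map fun k => emb2 Y i k).prod := by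
      refine chainCheck_commute hM.of_cons fun a ha b hb hab =>
        Commute.list_prod_right _ _ ?_
      simp only [List.mem_map, forall_exists_index, and_imp, forall_apply_eq_imp_iff₂]
      exact fun k hk => emb2_commute _ _ hab (hne i (by simp) k hk) (hiM a ha)
        (hne a (List.mem_cons_of_mem _ ha) k hk) (hiM b hb)
        (hne b (List.mem_cons_of_mem _ hb) k hk)
    have hpair : Commute (emb2 (PM n ℂ * X) i j)
        ((N.map fun k => emb2 Y i k).prod * (N.map fun k => emb2 Y j k).prod) := by
      rw [← prod_map_mul_of_commute]
      · refine Commute.list_prod_right _ _ ?_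
        simp only [List.mem_map, forall_exists_index, and_imp, forall_apply_eq_imp_iff₂]
        exact fun k hk => check_commute h hij (hne i (by simp) k hk) (hne j (by simp) k hk)
      · refine hN.imp_of_mem fun {a b} ha hb hab => ?_
        exact emb2_commute _ _ (hne j (by simp) a ha) (hne i (by simp) b hb) hij.symm
          (hne j (by simp) b hb) (hne i (by simp) a ha).symm hab
    have hrest : Commute (emb2 (PM n ℂ * X) i j) (fuse Y M N) := by
      refine Commute.list_prod_right _ _ ?_
      simp only [List.mem_map, forall_exists_index, and_imp, forall_apply_eq_imp_iff₂]
      intro a ha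
      refine Commute.list_prod_right _ _ ?_
      simp only [List.mem_map, forall_exists_index, and_imp, forall_apply_eq_imp_iff₂]
      exact fun k hk => emb2_commute _ _ hij (hne a (by simp [ha]) k hk)
        (hiM a (by simp [ha])).symm (hne i (by simp) k hk) (hjM a ha).symm
        (hne j (by simp) k hk)
    rw [chainCheck, fuse_cons]
    refine Commute.mul_left ?_ (hrow.mul_right ih)
    rw [fuse_cons, ← mul_assoc]
    exact hpair.mul_right hrest

lemma fuse_perm2 (Y : M2 n ℂ) {N : List ι} (hN : N.Nodup) :
    ∀ {M : List ι}, M.Nodup → M.Disjoint N → fuse (perm2 Y) M N = fuse Y N M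
  | [], _, _ => by simp [fuse]
  | i :: M, hM, hd => by
    rw [fuse_cons, fuse_perm2 Y hN hM.of_cons (List.disjoint_of_disjoint_cons_left hd)]
    simp only [emb2_perm2, fuse, List.map_cons, List.prod_cons]
    rw [prod_map_mul_of_commute]
    refine hN.imp_of_mem fun {a b} ha hb hab => ?_
    refine Commute.list_prod_left _ _ ?_
    simp only [List.mem_map, forall_exists_index, and_imp, forall_apply_eq_imp_iff₂]
    have hne : ∀ c ∈ i :: M, ∀ k ∈ N, k ≠ c := fun c hc k hk e => hd hc (e ▸ hk)
    exact fun c hc => emb2_commute _ _ (hne c (by simp [hc]) a ha) (hne i (by simp) b hb) hab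
      (hne i (by simp) a ha) (hne c (by simp [hc]) b hb).symm
      fun e => (List.nodup_cons.1 hM).1 (e ▸ hc)

lemma prod_map_reverse_mul_prod_map {κ G : Type*} [Monoid G] (f g : κ → G) :
    ∀ {l : List κ}, (∀ a ∈ l, f a * g a = 1) →
      (l.reverse.map f).prod * (l.map g).prod = 1
  | [], _ => by simp
  | a :: l, h => by
    have ih := prod_map_reverse_mul_prod_map f g (l := l)
      fun b hb => h b (List.mem_cons_of_mem _ hb)
    simp only [List.reverse_cons, List.map_append, List.map_cons, List.map_nil,
      List.prod_append, List.prod_cons, List.prod_nil, mul_one, mul_assoc]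
    rw [← mul_assoc (f a), h a (by simp), one_mul, ih]

lemma fuse_reverse_mul_fuse {X Y : M2 n ℂ} (h : X * Y = 1) {M N : List ι}
    (hd : M.Disjoint N) : fuse X M.reverse N.reverse * fuse Y M N = 1 :=
  prod_map_reverse_mul_prod_map _ _ fun i hi =>
    prod_map_reverse_mul_prod_map _ _ fun j hj => by
      have hij : i ≠ j := fun e => hd hi (e ▸ hj)
      rw [← emb2_mul _ _ hij, h, emb2_one]

lemma commute_of_mul_eq_one {Q F G : Tens ι n ℂ} (h : Commute Q F) (hGF : G * F = 1) :
    Commute Q G := by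
  have hFG : F * G = 1 := mul_eq_one_comm.1 hGF
  calc Q * G = G * F * (Q * G) := by rw [hGF, one_mul]
    _ = G * (F * Q) * G := by simp only [mul_assoc]
    _ = G * (Q * F) * G := by rw [h.eq]
    _ = G * Q * (F * G) := by simp only [mul_assoc]
    _ = G * Q := by rw [hFG, mul_one]

lemma chainCheck_commute_fuse_reverse {X : M2 n ℂ}
    (h : emb2 (ι := Fin 3) X 0 1 * emb2 X 0 2 * emb2 X 1 2
       = emb2 X 1 2 * emb2 X 0 2 * emb2 X 0 1) (hU : X * perm2 X = 1)
    {M N : List ι} (hM : M.Nodup) (hN : N.Nodup) (hd : M.Disjoint N) :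
    Commute (chainCheck X N) (fuse X M N.reverse) := by
  have hd' : N.Disjoint M.reverse := by simpa using hd.symm
  have hinv := fuse_reverse_mul_fuse (mul_eq_one_comm.1 hU) hd'
  rw [List.reverse_reverse] at hinv
  rw [← perm2_perm2 X, fuse_perm2 (perm2 X) (List.nodup_reverse.2 hN) hM (by simpa using hd)]
  exact commute_of_mul_eq_one
    (chainCheck_commute_fuse h (List.nodup_reverse.2 hM) hN hd') hinv

/-- the particular dressing matrices `Q_M = Ǎ₁₂⋯Ǎ_{m-1,m}`,
`S_M = Ď₁₂⋯Ď_{m-1,m}` satisfy the dressing constraints. -/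
theorem particular_dressing {n : ℕ} (hn : 1 ≤ n)
    (A B C D : M2 n ℂ)
    (hYBA : emb2 (ι := Fin 3) A 0 1 * emb2 A 0 2 * emb2 A 1 2
          = emb2 A 1 2 * emb2 A 0 2 * emb2 A 0 1)
    (hYBAC : emb2 (ι := Fin 3) A 0 1 * emb2 C 0 2 * emb2 C 1 2
          = emb2 C 1 2 * emb2 C 0 2 * emb2 A 0 1)
    (hYBD : emb2 (ι := Fin 3) D 0 1 * emb2 D 0 2 * emb2 D 1 2
          = emb2 D 1 2 * emb2 D 0 2 * emb2 D 0 1)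
    (hYBDB : emb2 (ι := Fin 3) D 0 1 * emb2 B 0 2 * emb2 B 1 2
          = emb2 B 1 2 * emb2 B 0 2 * emb2 D 0 1)
    (hUA : A * perm2 A = 1) (hUD : D * perm2 D = 1) (hBC : B = perm2 C)
    {ι : Type} [Fintype ι] [DecidableEq ι] (M N : List ι) (hMN : OkPair M N) :
    Commute (chainCheck A M) (fuse A M N.reverse) ∧
    Commute (chainCheck A N) (fuse A M N.reverse) ∧
    Commute (chainCheck A N) (fuse B M N) ∧
    Commute (chainCheck A M) (fuse C M N) ∧
    Commute (chainCheck D M) (fuse D M N.reverse) ∧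
    Commute (chainCheck D N) (fuse D M N.reverse) ∧
    Commute (chainCheck D N) (fuse C M N) ∧
    Commute (chainCheck D M) (fuse B M N) := by
  obtain ⟨hM, hN, hd⟩ := hMN
  have hNr := List.nodup_reverse.2 hN
  have hdr : M.Disjoint N.reverse := by simpa using hd
  have hCB : C = perm2 B := by rw [hBC, perm2_perm2]
  refine ⟨chainCheck_commute_fuse hYBA hNr hM hdr,
    chainCheck_commute_fuse_reverse hYBA hUA hM hN hd, ?_,
    chainCheck_commute_fuse hYBAC hN hM hd,
    chainCheck_commute_fuse hYBD hNr hM hdr,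
    chainCheck_commute_fuse_reverse hYBD hUD hM hN hd, ?_,
    chainCheck_commute_fuse hYBDB hN hM hd⟩
  · rw [hBC, fuse_perm2 C hN hM hd]
    exact chainCheck_commute_fuse hYBAC hM hN hd.symm
  · rw [hCB, fuse_perm2 B hN hM hd]
    exact chainCheck_commute_fuse hYBDB hM hN hd.symm

end QT
end

section
/- Let {T_M ∈ End(V^{⊗M})⊗R} be a family satisfying the KS-type fused exchange relation A_{MN̄′}T_M B_{MN′}T_{N′} = T_{N′}C_{MN′}T_M D_{MN̄′} for all disjoint ordered label sets M, N′. Suppose scalar matrices L_M ∈ End(V^{⊗M}) satisfy, for all disjoint M, N′, the intertwining relations: L_M A_{MN̄′} = A_{M̄N̄′} L_M, L_{N′} A_{MN̄′} = A_{MN′} L_{N′}, L_{N′} B_{MN′} = B_{MN̄′} L_{N′}, L_M C_{MN′} = C_{M̄N′} L_M. Then the family T̃_M := L_M T_M satisfies the DKM-type fused exchange relation A_{M̄N′} T̃_M B_{MN̄′} T̃_{N′} = T̃_{N′} C_{M̄N′} T̃_M D_{MN̄′} for all disjoint M, N′. -/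
open Matrix

namespace QT

variable {n : ℕ} {ι : Type*} [Fintype ι] [DecidableEq ι] {α : Type*}
variable {R : Type*} [Ring R] [Algebra ℂ R]

theorem embS_eq_submatrix_blockDiagonal [Zero α] (M : List ι)
    (X : Matrix (idx n M) (idx n M) α) :
    (embS M X : Tens ι n α) =
      (blockDiagonal fun _ : {x // x ∉ M.toFinset} → Fin n => X).submatrix
        (Equiv.piEquivPiSubtypeProd (· ∈ M.toFinset) fun _ => Fin n)
        (Equiv.piEquivPiSubtypeProd (· ∈ M.toFinset) fun _ => Fin n) := by
  ext f g
  simp [embS, blockDiagonal_apply, Equiv.piEquivPiSubtypeProd, funext_iff]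

theorem embS_mul [Semiring α] (M : List ι) (X Y : Matrix (idx n M) (idx n M) α) :
    (embS M (X * Y) : Tens ι n α) = embS M X * embS M Y := by
  simp only [embS_eq_submatrix_blockDiagonal, submatrix_mul_equiv, ← blockDiagonal_mul]

theorem embS_map {β : Type*} [Zero α] [Zero β] (M : List ι) (X : Matrix (idx n M) (idx n M) α)
    (φ : α → β) (hφ : φ 0 = 0) :
    (embS M (X.map φ) : Tens ι n β) = (embS M X : Tens ι n α).map φ := by
  ext f g
  simp [embS, apply_ite φ, hφ]

theorem embS_mul_embS_apply [Semiring α] {M N : List ι} (h : M.Disjoint N)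
    (X : Matrix (idx n M) (idx n M) α) (Y : Matrix (idx n N) (idx n N) α) (f g : ι → Fin n) :
    (embS M X * embS N Y : Tens ι n α) f g =
      if ∀ k, k ∉ M → k ∉ N → f k = g k then
        X (fun i => f i.1) (fun i => g i.1) * Y (fun i => f i.1) (fun i => g i.1) else 0 := by
  have hM : ∀ i : {x // x ∈ M.toFinset}, i.1 ∈ M := fun i => List.mem_toFinset.1 i.2
  have hN : ∀ i : {x // x ∈ N.toFinset}, i.1 ∉ M :=
    fun i hi => h hi (List.mem_toFinset.1 i.2)
  rw [mul_apply, Finset.sum_eq_single fun k => if k ∈ M then g k else f k]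
  · have h₁ : ∀ k, k ∉ M → f k = if k ∈ M then g k else f k := fun k hk => by simp [hk]
    have h₂ : (∀ k, k ∉ N → (if k ∈ M then g k else f k) = g k) ↔
        ∀ k, k ∉ M → k ∉ N → f k = g k := by
      refine forall_congr' fun k => ?_
      by_cases hk : k ∈ M <;> simp [hk]
    simp only [embS, of_apply, List.mem_toFinset, h₂, if_pos h₁, hM, hN, if_true, if_false,
      mul_ite, mul_zero]
  · intro b _ hb
    by_contra hne
    refine hb (funext fun k => ?_)
    simp only [embS, of_apply, List.mem_toFinset] at hne
    split_ifs at hne with h₁ h₂ <;> try simp only [mul_zero, zero_mul, not_true_eq_false] at hne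
    split_ifs with hk
    · exact h₂ k (h hk)
    · exact (h₁ k hk).symm
  · simp

theorem embS_commute_of_disjoint [Semiring α] {M N : List ι} (h : M.Disjoint N)
    (X : Matrix (idx n M) (idx n M) α) (Y : Matrix (idx n N) (idx n N) α)
    (hXY : ∀ i j k l, Commute (X i j) (Y k l)) :
    Commute (embS M X : Tens ι n α) (embS N Y) := by
  ext f g
  rw [embS_mul_embS_apply h, embS_mul_embS_apply h.symm, hXY]
  congr 1
  exact propext ⟨fun H k hN hM => H k hM hN, fun H k hM hN => H k hN hM⟩

/-- the coupling matrices `L_M` turn KS-type fused solutions into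
DKM-type fused solutions. -/
theorem coupling_to_DKM {n : ℕ} (hn : 1 ≤ n)
    {ι : Type} [Fintype ι] [DecidableEq ι]
    {R : Type*} [Ring R] [Algebra ℂ R]
    (A B C D : M2 n ℂ)
    (T : (M : List ι) → Matrix (idx n M) (idx n M) R)
    (L : (M : List ι) → Matrix (idx n M) (idx n M) ℂ)
    (hT : ∀ M N : List ι, OkPair M N →
      (fuse A M N.reverse).map (algebraMap ℂ R) * embS M (T M) *
        (fuse B M N).map (algebraMap ℂ R) * embS N (T N)
      = embS N (T N) * (fuse C M N).map (algebraMap ℂ R) * embS M (T M) *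
        (fuse D M N.reverse).map (algebraMap ℂ R))
    (hL : ∀ M N : List ι, OkPair M N →
      embS M (L M) * fuse A M N.reverse = fuse A M.reverse N.reverse * embS M (L M) ∧
      embS N (L N) * fuse A M N.reverse = fuse A M N * embS N (L N) ∧
      embS N (L N) * fuse B M N = fuse B M N.reverse * embS N (L N) ∧
      embS M (L M) * fuse C M N = fuse C M.reverse N * embS M (L M)) :
    ∀ M N : List ι, OkPair M N →
      (fuse A M.reverse N).map (algebraMap ℂ R) * embS M ((L M).map (algebraMap ℂ R) * T M) *
        (fuse B M N.reverse).map (algebraMap ℂ R) * embS N ((L N).map (algebraMap ℂ R) * T N)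
      = embS N ((L N).map (algebraMap ℂ R) * T N) * (fuse C M.reverse N).map (algebraMap ℂ R) *
        embS M ((L M).map (algebraMap ℂ R) * T M) * (fuse D M N.reverse).map (algebraMap ℂ R) := by
  intro M N hMN
  obtain ⟨hM, hN, hd⟩ := hMN
  obtain ⟨hLA, -, hLB, hLC⟩ := hL M N ⟨hM, hN, hd⟩
  obtain ⟨-, hLA', -, -⟩ := hL M.reverse N
    ⟨List.nodup_reverse.2 hM, hN, fun _ h => hd (List.mem_reverse.1 h)⟩
  have key := hT M N ⟨hM, hN, hd⟩
  let φ : Tens ι n ℂ →+* Tens ι n R := (algebraMap ℂ R).mapMatrix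
  have hφ : ∀ X : Tens ι n ℂ, X.map (algebraMap ℂ R) = φ X := fun _ => rfl
  have hmap : ∀ P : List ι,
      (embS P ((L P).map (algebraMap ℂ R)) : Tens ι n R) = φ (embS P (L P)) :=
    fun P => embS_map P (L P) _ (map_zero _)
  have cLL := embS_commute_of_disjoint hd (L M) (L N) fun _ _ _ _ => Commute.all _ _
  have cNM := embS_commute_of_disjoint hd.symm ((L N).map (algebraMap ℂ R)) (T M)
    fun _ _ _ _ => Algebra.commutes _ _
  have cMN := embS_commute_of_disjoint hd ((L M).map (algebraMap ℂ R)) (T N)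
    fun _ _ _ _ => Algebra.commutes _ _
  simp only [embS_mul, hmap, hφ] at key cNM cMN ⊢
  have eA := congrArg φ (show fuse A M.reverse N * embS M (L M) * embS N (L N) =
      embS M (L M) * embS N (L N) * fuse A M N.reverse by
    rw [mul_assoc, cLL.eq, ← mul_assoc, ← hLA', mul_assoc, ← hLA, mul_assoc])
  have eB := congrArg φ hLB
  have eC := congrArg φ hLC
  have eL := congrArg φ cLL.eq
  simp only [map_mul] at eA eB eC eL
  generalize φ (fuse A M.reverse N) = a' at *
  generalize φ (fuse A M N.reverse) = a at *
  generalize φ (fuse B M N.reverse) = b' at *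
  generalize φ (fuse B M N) = b at *
  generalize φ (fuse C M.reverse N) = c' at *
  generalize φ (fuse C M N) = c at *
  generalize φ (fuse D M N.reverse) = d at *
  generalize φ (embS M (L M)) = lM at *
  generalize φ (embS N (L N)) = lN at *
  generalize (embS M (T M) : Tens ι n R) = tM at *
  generalize (embS N (T N) : Tens ι n R) = tN at *
  calc a' * (lM * tM) * b' * (lN * tN)
      = a' * lM * tM * (b' * lN) * tN := by simp only [mul_assoc]
    _ = a' * lM * (lN * tM) * b * tN := by rw [← eB, cNM.eq]; simp only [mul_assoc]
    _ = a' * lM * lN * tM * b * tN := by simp only [mul_assoc]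
    _ = lM * lN * (a * tM * b * tN) := by rw [eA]; simp only [mul_assoc]
    _ = lN * (lM * tN) * c * tM * d := by rw [key, eL]; simp only [mul_assoc]
    _ = lN * tN * (lM * c) * tM * d := by rw [cMN.eq]; simp only [mul_assoc]
    _ = lN * tN * c' * (lM * tM) * d := by rw [eC]; simp only [mul_assoc]

end QT
end
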